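/- Suppose α, β > 0, α(‖P‖ + β‖H‖²) < 1, and ρ ∈ (0, 2), and let (z^j, w^j, ξ^j, η^j) be the xPIPG iterates from arbitrary initial points ξ¹ ∈ ℝ^n, η¹ ∈ ℝ^m. Then the limit z̄ := lim_{j→∞} (z^{j+1} − z^j) exists, belongs to rec D, and satisfies H z̄ ∈ K, P z̄ = 0, and ⟨q, z̄⟩ = −(1/(ρα))‖z̄‖². -/

import Mathlib

open scoped RealInnerProductSpace
open Filter Topology Matrix

/-- Spectral norm (largest singular value) of a real matrix. -/
noncomputable def specNorm {ι κ : Type*} [Fintype ι] [Fintype κ] [DecidableEq κ]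
    (A : Matrix ι κ ℝ) : ℝ :=
  ‖LinearMap.toContinuousLinearMap (Matrix.toEuclideanLin A)‖

/-- The linear map on Euclidean space induced by a matrix (matrix-vector product). -/
noncomputable def mvec {ι κ : Type*} [Fintype ι] [Fintype κ] [DecidableEq κ]
    (A : Matrix ι κ ℝ) (x : EuclideanSpace ℝ κ) : EuclideanSpace ℝ ι :=
  Matrix.toEuclideanLin A x

open Classical in
/-- Projection onto a (nonempty closed convex) set: the minimizer of the distance to `x`. -/
noncomputable def proj {ι : Type*} [Fintype ι] (C : Set (EuclideanSpace ℝ ι))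
    (x : EuclideanSpace ℝ ι) : EuclideanSpace ℝ ι :=
  if h : ∃ y ∈ C, ∀ c ∈ C, ‖x - y‖ ≤ ‖x - c‖ then h.choose else x

/-- Polar cone `K° = {w | ⟨w, y⟩ ≤ 0 for all y ∈ K}`. -/
def polarCone {ι : Type*} [Fintype ι] (K : Set (EuclideanSpace ℝ ι)) :
    Set (EuclideanSpace ℝ ι) := {w | ∀ y ∈ K, ⟪w, y⟫ ≤ 0}

/-- Recession cone `rec D = {y | y + z ∈ D for all z ∈ D}`. -/
def recCone {ι : Type*} [Fintype ι] (D : Set (EuclideanSpace ℝ ι)) :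
    Set (EuclideanSpace ℝ ι) := {y | ∀ z ∈ D, y + z ∈ D}

/-- Normal cone of `C` at `x`: `N_C(x) = {y | ⟨y, x' − x⟩ ≤ 0 for all x' ∈ C}`. -/
def normalCone {ι : Type*} [Fintype ι] (C : Set (EuclideanSpace ℝ ι))
    (x : EuclideanSpace ℝ ι) : Set (EuclideanSpace ℝ ι) :=
  {y | ∀ x' ∈ C, ⟪y, x' - x⟫ ≤ 0}

/-- A closed convex cone. -/
def IsClosedConvexCone {ι : Type*} [Fintype ι] (K : Set (EuclideanSpace ℝ ι)) : Prop :=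
  IsClosed K ∧ Convex ℝ K ∧ ∀ w ∈ K, ∀ c : ℝ, 0 ≤ c → c • w ∈ K

/-- Support function of `D`, valued in `EReal`: `σ_D(x) = sup_{y ∈ D} ⟨y, x⟩`. -/
noncomputable def supportF {ι : Type*} [Fintype ι] (D : Set (EuclideanSpace ℝ ι))
    (x : EuclideanSpace ℝ ι) : EReal :=
  ⨆ y : D, ((⟪(y : EuclideanSpace ℝ ι), x⟫ : ℝ) : EReal)

section Averaged

theorem norm_sub_add_le {X : Type*} [SeminormedAddCommGroup X] {u : ℕ → X}
    (h : ∀ i j, ‖u (i + 1) - u (j + 1)‖ ≤ ‖u i - u j‖) (i j k : ℕ) :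
    ‖u (i + k) - u (j + k)‖ ≤ ‖u i - u j‖ := by
  induction k with
  | zero => simp
  | succ k ih => exact (h (i + k) (j + k)).trans ih

theorem norm_sub_le_sum {X : Type*} [SeminormedAddCommGroup X] (u : ℕ → X) (k : ℕ) :
    ‖u k - u 0‖ ≤ ∑ i ∈ Finset.range k, ‖u (i + 1) - u i‖ := by
  rw [← Finset.sum_range_sub]
  exact norm_sum_le _ _

variable {X : Type*} [NormedAddCommGroup X] [InnerProductSpace ℝ X]

theorem norm_sub_sq_succ_le {u : ℕ → X} {κ : ℝ}
    (h : ∀ i j, ⟪u i - u j, (u (i + 1) - u i) - (u (j + 1) - u j)⟫ ≤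
      -κ * ‖(u (i + 1) - u i) - (u (j + 1) - u j)‖ ^ 2) (i j : ℕ) :
    (2 * κ - 1) * ‖(u (i + 1) - u i) - (u (j + 1) - u j)‖ ^ 2 ≤
      ‖u i - u j‖ ^ 2 - ‖u (i + 1) - u (j + 1)‖ ^ 2 := by
  have e : u (i + 1) - u (j + 1) = (u i - u j) + ((u (i + 1) - u i) - (u (j + 1) - u j)) := by
    abel
  rw [e, norm_add_sq_real]
  linarith [h i j]

theorem mul_le_norm_sub_of_tendsto {u : ℕ → X} {L : ℝ}
    (h : ∀ i j, ‖u (i + 1) - u (j + 1)‖ ≤ ‖u i - u j‖)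
    (hL : Tendsto (fun j => ‖u (j + 1) - u j‖) atTop (𝓝 L))
    (hd : Tendsto (fun j => (u (j + 1 + 1) - u (j + 1)) - (u (j + 1) - u j)) atTop (𝓝 0))
    (k : ℕ) : k * L ≤ ‖u k - u 0‖ := by
  have h1 : ∀ k, Tendsto (fun j => (u (j + k + 1) - u (j + k)) - (u (j + 1) - u j))
      atTop (𝓝 0) := by
    intro k
    induction k with
    | zero => simp
    | succ k ih =>
      have := (hd.comp (tendsto_add_atTop_nat k)).add ih
      simp only [add_zero] at this
      refine this.congr fun j => ?_
      simp only [Function.comp, add_assoc]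
      abel
  have h2 : Tendsto (fun j => (u (j + k) - u j) - (k : ℝ) • (u (j + 1) - u j)) atTop (𝓝 0) := by
    induction k with
    | zero => simp
    | succ k ih =>
      have := ih.add (h1 k)
      simp only [add_zero] at this
      refine this.congr fun j => ?_
      push_cast
      rw [add_smul, one_smul, ← add_assoc]
      abel
  have h3 : Tendsto (fun j => k * ‖u (j + 1) - u j‖ -
      ‖(u (j + k) - u j) - (k : ℝ) • (u (j + 1) - u j)‖) atTop (𝓝 (k * L)) := by
    simpa using (hL.const_mul (k : ℝ)).sub h2.norm
  refine le_of_tendsto' h3 fun j => ?_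
  have h4 : ‖u (j + k) - u j‖ ≤ ‖u k - u 0‖ := by
    simpa [add_comm] using norm_sub_add_le h k 0 j
  have h5 := norm_sub_norm_le ((k : ℝ) • (u (j + 1) - u j)) (u (j + k) - u j)
  rw [norm_smul, Real.norm_natCast, norm_sub_rev (_ • _)] at h5
  linarith

/-- A record-setting index `n` for `‖u n - u 0‖ - n (L - ε)` gives a direction along which all
earlier displacements grow at rate at least `L - ε`. -/
theorem exists_le_inner_sub {u : ℕ → X} {L ε : ℝ}
    (h : ∀ i j, ‖u (i + 1) - u (j + 1)‖ ≤ ‖u i - u j‖)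
    (hL : ∀ k : ℕ, k * L ≤ ‖u k - u 0‖) (hε : 0 < ε) (N : ℕ) :
    ∃ n ≥ N, ∀ k ≤ n, ‖u n - u 0‖ * (k * (L - ε)) ≤ ⟪u n - u 0, u k - u 0⟫ := by
  have h1 : Tendsto (fun n : ℕ => ‖u n - u 0‖ - n * (L - ε)) atTop atTop := by
    refine tendsto_atTop_mono (fun n => ?_) (tendsto_natCast_atTop_atTop.atTop_mul_const hε)
    linarith [hL n]
  obtain ⟨n, hn, hr⟩ := high_scores h1 N
  refine ⟨n, hn, fun k hk => ?_⟩
  have h2 : ‖u n - u k‖ ≤ ‖u n - u 0‖ - k * (L - ε) := by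
    have h3 : ‖u n - u k‖ ≤ ‖u (n - k) - u 0‖ := by
      simpa [Nat.sub_add_cancel hk] using norm_sub_add_le h (n - k) 0 k
    have h4 : ‖u (n - k) - u 0‖ - (n - k : ℕ) * (L - ε) ≤ ‖u n - u 0‖ - n * (L - ε) := by
      rcases Nat.eq_zero_or_pos k with rfl | hk0
      · simp
      · exact (hr (n - k) (by omega)).le
    rw [Nat.cast_sub hk] at h4
    linarith
  have e : ⟪u n - u 0, u k - u 0⟫ = ‖u n - u 0‖ ^ 2 - ⟪u n - u 0, u n - u k⟫ := by
    rw [← real_inner_self_eq_norm_sq, ← inner_sub_right]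
    congr 1
    abel
  rw [e]
  nlinarith [real_inner_le_norm (u n - u 0) (u n - u k), norm_nonneg (u n - u 0)]

theorem cauchySeq_smul_sub {u : ℕ → X} {L : ℝ} (hL0 : 0 ≤ L)
    (h : ∀ i j, ‖u (i + 1) - u (j + 1)‖ ≤ ‖u i - u j‖)
    (hL : ∀ k : ℕ, k * L ≤ ‖u k - u 0‖)
    (hm : Tendsto (fun k : ℕ => ‖(k : ℝ)⁻¹ • (u k - u 0)‖) atTop (𝓝 L)) :
    CauchySeq (fun k : ℕ => (k : ℝ)⁻¹ • (u k - u 0)) := by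
  rw [Metric.cauchySeq_iff]
  intro δ hδ
  set m : ℕ → X := fun k => (k : ℝ)⁻¹ • (u k - u 0) with hmdef
  set ε : ℝ := δ ^ 2 / (16 * (L + 1)) with hεdef
  have hε : 0 < ε := by positivity
  have hε' : ε * (L + 1) = δ ^ 2 / 16 := by rw [hεdef]; field_simp
  have h1 : ∀ᶠ k in atTop, ‖m k‖ ^ 2 < L ^ 2 + δ ^ 2 / 32 :=
    (hm.pow 2).eventually_lt_const (by linarith [pow_pos hδ 2])
  have h2 : ∀ᶠ k in atTop, ‖m k‖ < L + 1 := hm.eventually_lt_const (by linarith)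
  obtain ⟨N, hN⟩ := eventually_atTop.1 ((h1.and h2).and (eventually_ge_atTop 1))
  refine ⟨N, fun k hk l hl => ?_⟩
  obtain ⟨n, hn, hi⟩ := exists_le_inner_sub h hL hε (max k l)
  have hnN : N ≤ n := hk.trans ((le_max_left _ _).trans hn)
  have key : ∀ i, N ≤ i → i ≤ n → ‖m i - m n‖ ^ 2 < δ ^ 2 / 4 := by
    intro i hi1 hi2
    have hi0 : (0 : ℝ) < i := by exact_mod_cast (hN i hi1).2
    have hn0 : (0 : ℝ) < n := by exact_mod_cast (hN n hnN).2
    have hmn : L ≤ ‖m n‖ := by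
      rw [hmdef]
      simp only [norm_smul, norm_inv, Real.norm_natCast]
      rw [inv_mul_eq_div, le_div_iff₀ hn0, mul_comm]
      exact hL n
    have hin : ‖m n‖ * (L - ε) ≤ ⟪m i, m n⟫ := by
      have := hi i hi2
      rw [real_inner_comm]
      simp only [hmdef, norm_smul, norm_inv, Real.norm_natCast, real_inner_smul_left,
        real_inner_smul_right]
      calc (n : ℝ)⁻¹ * ‖u n - u 0‖ * (L - ε)
          = (i : ℝ)⁻¹ * ((n : ℝ)⁻¹ * (‖u n - u 0‖ * (i * (L - ε)))) := by field_simp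
        _ ≤ _ := by
          have hn0' := inv_pos.2 hn0
          have hi0' := inv_pos.2 hi0
          exact mul_le_mul_of_nonneg_left (mul_le_mul_of_nonneg_left this hn0'.le) hi0'.le
    have := (hN i hi1).1.1
    have := (hN n hnN).1.1
    have := (hN n hnN).1.2
    rw [norm_sub_sq_real]
    nlinarith
  have hk' := key k hk ((le_max_left _ _).trans hn)
  have hl' := key l hl ((le_max_right _ _).trans hn)
  have hk'' := abs_lt_of_sq_lt_sq (a := ‖m k - m n‖) (b := δ / 2) (by linarith) (by linarith)
  have hl'' := abs_lt_of_sq_lt_sq (a := ‖m l - m n‖) (b := δ / 2) (by linarith) (by linarith)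
  rw [abs_norm] at hk'' hl''
  rw [dist_eq_norm]
  have := norm_sub_le_norm_sub_add_norm_sub (m k) (m n) (m l)
  rw [norm_sub_rev (m n)] at this
  linarith

/-- The displacements of an averaged nonexpansive iteration converge. -/
theorem exists_tendsto_sub_of_inner_le [CompleteSpace X] {u : ℕ → X} {κ : ℝ} (hκ : 1 / 2 < κ)
    (h : ∀ i j, ⟪u i - u j, (u (i + 1) - u i) - (u (j + 1) - u j)⟫ ≤
      -κ * ‖(u (i + 1) - u i) - (u (j + 1) - u j)‖ ^ 2) :
    ∃ v, Tendsto (fun j => u (j + 1) - u j) atTop (𝓝 v) := by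
  have hc : 0 < 2 * κ - 1 := by linarith
  have hsq := norm_sub_sq_succ_le h
  have hne : ∀ i j, ‖u (i + 1) - u (j + 1)‖ ≤ ‖u i - u j‖ := fun i j => by
    refine le_of_sq_le_sq ?_ (norm_nonneg _)
    have := hsq i j
    have : 0 ≤ (2 * κ - 1) * ‖(u (i + 1) - u i) - (u (j + 1) - u j)‖ ^ 2 := by positivity
    linarith
  obtain ⟨L, hL⟩ : ∃ L, Tendsto (fun j => ‖u (j + 1) - u j‖) atTop (𝓝 L) :=
    ⟨_, tendsto_atTop_ciInf (antitone_nat_of_succ_le fun j => hne (j + 1) j)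
      ⟨0, by rintro _ ⟨j, rfl⟩; exact norm_nonneg _⟩⟩
  have hL0 : 0 ≤ L := ge_of_tendsto' hL fun _ => norm_nonneg _
  have hd : Tendsto (fun j => (u (j + 1 + 1) - u (j + 1)) - (u (j + 1) - u j)) atTop (𝓝 0) := by
    rw [tendsto_zero_iff_norm_tendsto_zero]
    have h1 : Tendsto (fun j => (2 * κ - 1)⁻¹ *
        (‖u (j + 1) - u j‖ ^ 2 - ‖u (j + 1 + 1) - u (j + 1)‖ ^ 2)) atTop (𝓝 0) := by
      simpa using ((hL.pow 2).sub ((hL.comp (tendsto_add_atTop_nat 1)).pow 2)).const_mul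
        (2 * κ - 1)⁻¹
    have h2 : Tendsto (fun j => ‖(u (j + 1 + 1) - u (j + 1)) - (u (j + 1) - u j)‖ ^ 2)
        atTop (𝓝 0) := by
      refine squeeze_zero (fun _ => by positivity) (fun j => ?_) h1
      rw [inv_mul_eq_div, le_div_iff₀ hc, mul_comm]
      exact hsq (j + 1) j
    simpa using h2.sqrt
  have hlow := mul_le_norm_sub_of_tendsto hne hL hd
  have hm : Tendsto (fun k : ℕ => ‖(k : ℝ)⁻¹ • (u k - u 0)‖) atTop (𝓝 L) := by
    refine tendsto_of_tendsto_of_tendsto_of_le_of_le' tendsto_const_nhds hL.cesaro ?_ ?_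
    · filter_upwards [eventually_gt_atTop 0] with k hk
      rw [norm_smul, norm_inv, Real.norm_natCast, inv_mul_eq_div,
        le_div_iff₀ (by exact_mod_cast hk), mul_comm]
      exact hlow k
    · filter_upwards with k
      rw [norm_smul, norm_inv, Real.norm_natCast]
      gcongr
      exact norm_sub_le_sum u k
  obtain ⟨v, hv⟩ := cauchySeq_tendsto_of_complete (cauchySeq_smul_sub hL0 hne hlow hm)
  have hvL : ‖v‖ = L := tendsto_nhds_unique hv.norm hm
  have hlim : ∀ j, L ^ 2 ≤ ⟪v, u (j + 1) - u j⟫ := by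
    intro j
    have h0 : Tendsto (fun k : ℕ => (k : ℝ)⁻¹) atTop (𝓝 0) := tendsto_inv_atTop_nhds_zero_nat
    have h1 : Tendsto (fun k : ℕ => v - (k : ℝ)⁻¹ • (u k - u j)) atTop (𝓝 0) := by
      have := (hv.add (h0.smul_const (u 0 - u j))).const_sub v
      simp only [zero_smul, add_zero, sub_self] at this
      refine this.congr fun k => ?_
      rw [← smul_add]
      congr 2
      abel
    have h2 : Tendsto (fun k : ℕ => ⟪v - (k : ℝ)⁻¹ • (u k - u j),
        (u (k + 1) - u k) - (u (j + 1) - u j)⟫) atTop (𝓝 0) := by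
      have hb : Tendsto (fun k : ℕ => ‖v - (k : ℝ)⁻¹ • (u k - u j)‖ *
          (‖u (k + 1) - u k‖ + ‖u (j + 1) - u j‖)) atTop (𝓝 0) := by
        simpa using h1.norm.mul (hL.add_const ‖u (j + 1) - u j‖)
      refine squeeze_zero_norm (fun k => ?_) hb
      refine (norm_inner_le_norm _ _).trans ?_
      gcongr
      exact norm_sub_le _ _
    have h3 : Tendsto (fun k : ℕ => (k : ℝ)⁻¹ * ∑ i ∈ Finset.range k, ⟪v, u (i + 1) - u i⟫)
        atTop (𝓝 (L ^ 2)) := by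
      rw [← hvL, ← real_inner_self_eq_norm_sq]
      refine (tendsto_const_nhds.inner hv).congr fun k => ?_
      rw [real_inner_smul_right, ← inner_sum, Finset.sum_range_sub]
    have h4 := h3.sub h2.cesaro
    rw [sub_zero] at h4
    refine le_of_tendsto h4 ?_
    filter_upwards [eventually_gt_atTop 0] with k hk
    have hk' : (0 : ℝ) < k := by exact_mod_cast hk
    rw [← mul_sub, ← Finset.sum_sub_distrib, inv_mul_eq_div, div_le_iff₀ hk', mul_comm]
    refine (Finset.sum_le_card_nsmul _ _ ⟪v, u (j + 1) - u j⟫ fun i _ => ?_).trans (by simp)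
    have h5 : ⟪(i : ℝ)⁻¹ • (u i - u j), (u (i + 1) - u i) - (u (j + 1) - u j)⟫ ≤ 0 := by
      rw [real_inner_smul_left]
      refine mul_nonpos_of_nonneg_of_nonpos (by positivity) ((h i j).trans ?_)
      nlinarith [sq_nonneg ‖(u (i + 1) - u i) - (u (j + 1) - u j)‖]
    rw [inner_sub_left, inner_sub_right v (u (i + 1) - u i)]
    linarith
  refine ⟨v, ?_⟩
  rw [tendsto_iff_norm_sub_tendsto_zero]
  have h1 : Tendsto (fun j => ‖u (j + 1) - u j‖ ^ 2 - L ^ 2) atTop (𝓝 0) := by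
    rw [← sub_self (L ^ 2)]
    exact (hL.pow 2).sub_const (L ^ 2)
  have h2 : Tendsto (fun j => ‖u (j + 1) - u j - v‖ ^ 2) atTop (𝓝 0) := by
    refine squeeze_zero (fun _ => by positivity) (fun j => ?_) h1
    rw [norm_sub_sq_real, real_inner_comm, hvL]
    linarith [hlim j]
  simpa using h2.sqrt

end Averaged

section PrimalDual

open ContinuousLinearMap (adjoint)

variable {E F : Type*} [NormedAddCommGroup E] [InnerProductSpace ℝ E]
  [NormedAddCommGroup F] [InnerProductSpace ℝ F]

/-- Averages of the increments of a sequence with converging increments. -/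
theorem tendsto_inv_smul_of_tendsto_sub {E : Type*} [NormedAddCommGroup E] [NormedSpace ℝ E]
    {u : ℕ → E} {v : E}
    (h : Tendsto (fun j => u (j + 1) - u j) atTop (𝓝 v)) :
    Tendsto (fun j : ℕ => (j : ℝ)⁻¹ • u j) atTop (𝓝 v) := by
  have h0 : Tendsto (fun k : ℕ => (k : ℝ)⁻¹) atTop (𝓝 0) := tendsto_inv_atTop_nhds_zero_nat
  have := h.cesaro_smul.add (h0.smul_const (u 0))
  simp only [zero_smul, add_zero] at this
  refine this.congr fun k => ?_
  rw [Finset.sum_range_sub, ← smul_add, sub_add_cancel]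

theorem mem_of_tendsto_inv_smul {K : Set F} (hKcl : IsClosed K)
    (hK : ∀ x ∈ K, ∀ c : ℝ, 0 ≤ c → c • x ∈ K) {u : ℕ → F} (hu : ∀ j, u j ∈ K) {v : F}
    (h : Tendsto (fun j : ℕ => (j : ℝ)⁻¹ • u j) atTop (𝓝 v)) : v ∈ K :=
  hKcl.mem_of_tendsto h (Eventually.of_forall fun j => hK _ (hu j) _ (by positivity))

theorem add_mem_of_tendsto_inv_smul {D : Set E} (hDcl : IsClosed D) (hDcv : Convex ℝ D)
    {u : ℕ → E} (hu : ∀ j, u j ∈ D) {v : E}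
    (h : Tendsto (fun j : ℕ => (j : ℝ)⁻¹ • u j) atTop (𝓝 v)) {x : E} (hx : x ∈ D) :
    v + x ∈ D := by
  have h0 : Tendsto (fun k : ℕ => 1 - (k : ℝ)⁻¹) atTop (𝓝 1) := by
    simpa using (tendsto_inv_atTop_nhds_zero_nat (𝕜 := ℝ)).const_sub 1
  have h1 := h.add (h0.smul_const x)
  rw [one_smul] at h1
  refine hDcl.mem_of_tendsto h1 ?_
  filter_upwards [eventually_ge_atTop 1] with j hj
  have hj' : ((j : ℝ))⁻¹ ≤ 1 := inv_le_one_of_one_le₀ (by exact_mod_cast hj)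
  exact hDcv (hu j) hx (by positivity) (by linarith) (by ring)

variable {P : E →L[ℝ] E} {H : E →L[ℝ] F} {q : E} {g : F} {α β ρ : ℝ}

theorem le_inner_self_sub_sub (hβ : 0 < β) (x : E) :
    (α⁻¹ - (‖P‖ + β * ‖H‖ ^ 2)) * ‖x‖ ^ 2 ≤
      α⁻¹ * ‖x‖ ^ 2 - ⟪P x, x⟫ - β * ‖H x‖ ^ 2 := by
  have h1 : ⟪P x, x⟫ ≤ ‖P‖ * ‖x‖ ^ 2 := by
    refine (real_inner_le_norm _ _).trans ?_
    nlinarith [P.le_opNorm x, norm_nonneg x]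
  have h2 : ‖H x‖ ^ 2 ≤ ‖H‖ ^ 2 * ‖x‖ ^ 2 := by
    rw [← mul_pow]
    gcongr
    exact H.le_opNorm x
  nlinarith

variable [FiniteDimensional ℝ E] [FiniteDimensional ℝ F]

theorem exists_inner_map_map_eq_of_isPositive {T : E →L[ℝ] E} (hT : T.IsPositive) :
    ∃ (r : ℕ) (S : E →L[ℝ] EuclideanSpace ℝ (Fin r)), ∀ x y, ⟪S x, S y⟫ = ⟪T x, y⟫ := by
  obtain ⟨r, u, rfl⟩ := ContinuousLinearMap.isPositive_iff_eq_sum_rankOne.1 hT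
  refine ⟨r, (EuclideanSpace.equiv (Fin r) ℝ).symm.toContinuousLinearMap ∘L
    ContinuousLinearMap.pi fun i => innerSL ℝ (u i), fun x y => ?_⟩
  simp [PiLp.inner_apply, sum_inner, real_inner_smul_left, mul_comm]

/-- A linear change of variables turning the metric `α⁻¹ - P - β H† H` into the Euclidean one. -/
theorem exists_linearMap_inner_eq (hP : P.IsPositive) (hα : 0 < α) (hβ : 0 < β)
    (hstep : α * (‖P‖ + β * ‖H‖ ^ 2) < 1) :
    ∃ (r : ℕ) (S : E →L[ℝ] EuclideanSpace ℝ (Fin r))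
      (S' : EuclideanSpace ℝ (Fin r) →ₗ[ℝ] E), (∀ x, S' (S x) = x) ∧
      ∀ x y, ⟪S x, S y⟫ = α⁻¹ * ⟪x, y⟫ - ⟪P x, y⟫ - β * ⟪H x, H y⟫ := by
  set T : E →L[ℝ] E := α⁻¹ • ContinuousLinearMap.id ℝ E - P - β • (adjoint H ∘L H) with hTdef
  have hTi : ∀ x y, ⟪T x, y⟫ = α⁻¹ * ⟪x, y⟫ - ⟪P x, y⟫ - β * ⟪H x, H y⟫ := fun x y => by
    simp [hTdef, inner_sub_left, real_inner_smul_left, ContinuousLinearMap.adjoint_inner_left]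
  have hc : 0 < α⁻¹ - (‖P‖ + β * ‖H‖ ^ 2) := by
    rw [sub_pos, ← one_div, lt_div_iff₀ hα, mul_comm]
    exact hstep
  have hcoer : ∀ x, (α⁻¹ - (‖P‖ + β * ‖H‖ ^ 2)) * ‖x‖ ^ 2 ≤ ⟪T x, x⟫ := fun x => by
    rw [hTi, real_inner_self_eq_norm_sq, real_inner_self_eq_norm_sq]
    exact le_inner_self_sub_sub hβ x
  have hT : T.IsPositive := by
    refine ⟨fun x y => ?_, fun x => ?_⟩
    · have := hP.inner_left_eq_inner_right x y
      simp only [ContinuousLinearMap.coe_coe]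
      rw [real_inner_comm (T y) x, hTi, hTi, this, real_inner_comm x y,
        real_inner_comm (H x) (H y), real_inner_comm (P y) x]
    · exact (by positivity : (0 : ℝ) ≤ _).trans (hcoer x)
  obtain ⟨r, S, hS⟩ := exists_inner_map_map_eq_of_isPositive hT
  have hker : LinearMap.ker (S : E →ₗ[ℝ] EuclideanSpace ℝ (Fin r)) = ⊥ := by
    rw [LinearMap.ker_eq_bot']
    intro x hx
    have h1 := hcoer x
    have h2 : S x = 0 := hx
    rw [← hS, h2, inner_zero_left] at h1
    by_contra hne
    have : 0 < ‖x‖ := norm_pos_iff.2 hne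
    have : 0 < (α⁻¹ - (‖P‖ + β * ‖H‖ ^ 2)) * ‖x‖ ^ 2 := by positivity
    linarith
  obtain ⟨S', hS'⟩ := LinearMap.exists_leftInverse_of_injective _ hker
  exact ⟨r, S, S', fun x => LinearMap.congr_fun hS' x, fun x y => (hS x y).trans (hTi x y)⟩

variable {D : Set E} {C : Set F} {z ξ : ℕ → E} {w η : ℕ → F}

theorem exists_tendsto_sub_of_primal_dual (hP : P.IsPositive) (hα : 0 < α) (hβ : 0 < β)
    (hstep : α * (‖P‖ + β * ‖H‖ ^ 2) < 1) (hρ0 : 0 < ρ) (hρ2 : ρ < 2)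
    (hzD : ∀ j, z j ∈ D) (hwC : ∀ j, w j ∈ C)
    (ha : ∀ j, ∀ x ∈ D,
      ⟪α⁻¹ • (ξ j - z j) - P (ξ j) - q - adjoint H (η j), x - z j⟫ ≤ 0)
    (hb : ∀ j, ∀ y ∈ C,
      ⟪β⁻¹ • (η j - w j) + H ((2 : ℝ) • z j - ξ j) - g, y - w j⟫ ≤ 0)
    (hξ : ∀ j, ξ (j + 1) - ξ j = ρ • (z j - ξ j))
    (hη : ∀ j, η (j + 1) - η j = ρ • (w j - η j)) :
    (∃ v, Tendsto (fun j => ξ (j + 1) - ξ j) atTop (𝓝 v)) ∧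
      ∃ v, Tendsto (fun j => η (j + 1) - η j) atTop (𝓝 v) := by
  obtain ⟨r, S, S', hS', hS⟩ := exists_linearMap_inner_eq hP hα hβ hstep
  have hsβ : 0 < √β := Real.sqrt_pos.2 hβ
  set Φ : E → F → WithLp 2 (EuclideanSpace ℝ (Fin r) × F) := fun x y =>
    WithLp.toLp 2 (S x, (√β)⁻¹ • y - √β • H x) with hΦ
  have hΦsub : ∀ x x' y y', Φ x y - Φ x' y' = Φ (x - x') (y - y') := fun x x' y y' => by
    simp only [hΦ, ← WithLp.toLp_sub, Prod.mk_sub_mk, map_sub, smul_sub]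
    congr 2
    abel
  have hΦsmul : ∀ (c : ℝ) x y, Φ (c • x) (c • y) = c • Φ x y := fun c x y => by
    simp only [hΦ, ← WithLp.toLp_smul, Prod.smul_mk, map_smul, smul_sub, smul_comm c]
  have hΦi : ∀ x x' y y', ⟪Φ x y, Φ x' y'⟫ = α⁻¹ * ⟪x, x'⟫ - ⟪P x, x'⟫ - ⟪y, H x'⟫ -
      ⟪H x, y'⟫ + β⁻¹ * ⟪y, y'⟫ := fun x x' y y' => by
    have e1 : (√β)⁻¹ * (√β)⁻¹ = β⁻¹ := by rw [← mul_inv, Real.mul_self_sqrt hβ.le]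
    have e2 : √β * √β = β := Real.mul_self_sqrt hβ.le
    have e3 : (√β)⁻¹ * √β = 1 := inv_mul_cancel₀ hsβ.ne'
    simp only [hΦ, WithLp.prod_inner_apply, hS, inner_sub_left, inner_sub_right,
      real_inner_smul_left, real_inner_smul_right]
    linear_combination ⟪y, y'⟫ * e1 + ⟪H x, H x'⟫ * e2 - (⟪y, H x'⟫ + ⟪H x, y'⟫) * e3
  have hmono : ∀ i j, ⟪Φ (ξ i - ξ j) (η i - η j),
      Φ ((z i - z j) - (ξ i - ξ j)) ((w i - w j) - (η i - η j))⟫ ≤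
      -‖Φ ((z i - z j) - (ξ i - ξ j)) ((w i - w j) - (η i - η j))‖ ^ 2 := fun i j => by
    have h1 := ha i (z j) (hzD j)
    have h2 := ha j (z i) (hzD i)
    have h3 := hb i (w j) (hwC j)
    have h4 := hb j (w i) (hwC i)
    have h5 := hP.inner_nonneg_left (z i - z j)
    have e1 : ⟪α⁻¹ • ((ξ i - ξ j) - (z i - z j)) - P (ξ i - ξ j) - adjoint H (η i - η j),
        z i - z j⟫ = -⟪α⁻¹ • (ξ i - z i) - P (ξ i) - q - adjoint H (η i), z j - z i⟫ -
          ⟪α⁻¹ • (ξ j - z j) - P (ξ j) - q - adjoint H (η j), z i - z j⟫ := by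
      rw [← neg_sub (z i) (z j), inner_neg_right, neg_neg, ← inner_sub_left]
      congr 1
      simp only [map_sub, smul_sub]
      abel
    have e2 : ⟪β⁻¹ • ((η i - η j) - (w i - w j)) + H ((2 : ℝ) • (z i - z j) - (ξ i - ξ j)),
        w i - w j⟫ = -⟪β⁻¹ • (η i - w i) + H ((2 : ℝ) • z i - ξ i) - g, w j - w i⟫ -
          ⟪β⁻¹ • (η j - w j) + H ((2 : ℝ) • z j - ξ j) - g, w i - w j⟫ := by
      rw [← neg_sub (w i) (w j), inner_neg_right, neg_neg, ← inner_sub_left]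
      congr 1
      simp only [map_sub, map_smul, smul_sub]
      abel
    replace h1 := e1.ge.trans' (by linarith : (0 : ℝ) ≤ _)
    replace h3 := e2.ge.trans' (by linarith : (0 : ℝ) ≤ _)
    clear h2 h4 e1 e2
    generalize ξ i - ξ j = x, z i - z j = x', η i - η j = y, w i - w j = y' at *
    have c1 := (hP.inner_left_eq_inner_right x x').trans (real_inner_comm _ _)
    have c2 := real_inner_comm x x'
    have c3 := real_inner_comm y y'
    have c4 := real_inner_comm (H x') y'
    have c5 := real_inner_comm (H x') y
    have c6 := real_inner_comm (H x) y'
    have c7 := real_inner_comm (H x) y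
    rw [← real_inner_self_eq_norm_sq, hΦi, hΦi]
    simp only [map_sub, map_smul, inner_sub_left, inner_sub_right, inner_add_left,
      real_inner_smul_left, ContinuousLinearMap.adjoint_inner_left] at h1 h3 h5 ⊢
    rw [c2, c3]
    linarith
  have hstepΦ : ∀ j, Φ (ξ (j + 1)) (η (j + 1)) - Φ (ξ j) (η j) =
      ρ • Φ (z j - ξ j) (w j - η j) := fun j => by
    rw [hΦsub, hξ, hη, hΦsmul]
  obtain ⟨v, hv⟩ := exists_tendsto_sub_of_inner_le (u := fun j => Φ (ξ j) (η j)) (κ := ρ⁻¹)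
    (by rw [one_div]; exact (inv_lt_inv₀ two_pos hρ0).2 hρ2) fun i j => by
      have e : ρ • Φ (z i - ξ i) (w i - η i) - ρ • Φ (z j - ξ j) (w j - η j) =
          ρ • Φ ((z i - z j) - (ξ i - ξ j)) ((w i - w j) - (η i - η j)) := by
        rw [← smul_sub, hΦsub]
        congr 2 <;> abel
      rw [hstepΦ, hstepΦ, e, hΦsub, real_inner_smul_right, norm_smul, mul_pow, Real.norm_eq_abs,
        sq_abs]
      have := mul_le_mul_of_nonneg_left (hmono i j) hρ0.le
      refine this.trans_eq ?_
      field_simp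
  simp only [hΦsub] at hv
  have hv1 : Tendsto (fun j => ξ (j + 1) - ξ j) atTop (𝓝 (S' v.fst)) := by
    have := ((S'.continuous_of_finiteDimensional.comp
      (WithLp.prod_continuous_ofLp 2 _ _).fst).tendsto v).comp hv
    refine this.congr fun j => ?_
    simp [hΦ, -map_sub, hS']
  refine ⟨⟨_, hv1⟩, √β • (v.snd + √β • H (S' v.fst)), ?_⟩
  have h2 := ((WithLp.prod_continuous_ofLp 2 _ _).snd.tendsto v).comp hv
  have := (h2.add (((H.continuous.tendsto _).comp hv1).const_smul √β)).const_smul √β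
  refine this.congr fun j => ?_
  simp [hΦ, -map_sub, smul_smul, hsβ.ne']

theorem ContinuousLinearMap.IsPositive.map_eq_zero_of_inner_nonpos (hP : P.IsPositive)
    {x : E} (hx : ⟪P x, x⟫ ≤ 0) : P x = 0 := by
  obtain ⟨r, S, hS⟩ := exists_inner_map_map_eq_of_isPositive hP
  rw [← hS, real_inner_self_nonpos] at hx
  rw [← inner_self_eq_zero (𝕜 := ℝ), ← hS, hx, inner_zero_left]

theorem improving_direction_of_primal_dual (hP : P.IsPositive)
    (hρ0 : 0 < ρ) (hDcl : IsClosed D) (hDcv : Convex ℝ D)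
    (hCcl : IsClosed C) (hCadd : ∀ x ∈ C, ∀ y ∈ C, x + y ∈ C)
    (hCsmul : ∀ x ∈ C, ∀ c : ℝ, 0 ≤ c → c • x ∈ C)
    (hzD : ∀ j, z j ∈ D) (hwC : ∀ j, w j ∈ C)
    (ha : ∀ j, ∀ x ∈ D,
      ⟪α⁻¹ • (ξ j - z j) - P (ξ j) - q - adjoint H (η j), x - z j⟫ ≤ 0)
    (hb : ∀ j, ∀ y ∈ C,
      ⟪β⁻¹ • (η j - w j) + H ((2 : ℝ) • z j - ξ j) - g, y - w j⟫ ≤ 0)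
    (hξ : ∀ j, ξ (j + 1) - ξ j = ρ • (z j - ξ j))
    (hη : ∀ j, η (j + 1) - η j = ρ • (w j - η j))
    {zb : E} {wb : F}
    (hξl : Tendsto (fun j => ξ (j + 1) - ξ j) atTop (𝓝 zb))
    (hηl : Tendsto (fun j => η (j + 1) - η j) atTop (𝓝 wb)) :
    Tendsto (fun j => z (j + 1) - z j) atTop (𝓝 zb) ∧ (∀ x ∈ D, zb + x ∈ D) ∧
      (∀ y ∈ C, ⟪H zb, y⟫ ≤ 0) ∧ P zb = 0 ∧ ⟪q, zb⟫ = -(1 / (ρ * α)) * ‖zb‖ ^ 2 := by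
  have hDz : Tendsto (fun j => z j - ξ j) atTop (𝓝 (ρ⁻¹ • zb)) := by
    refine (hξl.const_smul ρ⁻¹).congr fun j => ?_
    rw [hξ, inv_smul_smul₀ hρ0.ne']
  have hDw : Tendsto (fun j => w j - η j) atTop (𝓝 (ρ⁻¹ • wb)) := by
    refine (hηl.const_smul ρ⁻¹).congr fun j => ?_
    rw [hη, inv_smul_smul₀ hρ0.ne']
  have hzl : Tendsto (fun j => z (j + 1) - z j) atTop (𝓝 zb) := by
    have := hξl.add ((hDz.comp (tendsto_add_atTop_nat 1)).sub hDz)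
    rw [sub_self, add_zero] at this
    refine this.congr fun j => ?_
    simp only [Function.comp]
    abel
  have hwl : Tendsto (fun j => w (j + 1) - w j) atTop (𝓝 wb) := by
    have := hηl.add ((hDw.comp (tendsto_add_atTop_nat 1)).sub hDw)
    rw [sub_self, add_zero] at this
    refine this.congr fun j => ?_
    simp only [Function.comp]
    abel
  have ht : Tendsto (fun j : ℕ => (j : ℝ)⁻¹) atTop (𝓝 0) := tendsto_inv_atTop_nhds_zero_nat
  have htξ := tendsto_inv_smul_of_tendsto_sub hξl
  have htη := tendsto_inv_smul_of_tendsto_sub hηl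
  have htz := tendsto_inv_smul_of_tendsto_sub hzl
  have htw := tendsto_inv_smul_of_tendsto_sub hwl
  have hrec : ∀ x ∈ D, zb + x ∈ D := fun x hx => add_mem_of_tendsto_inv_smul hDcl hDcv hzD htz hx
  have hwbC : wb ∈ C := mem_of_tendsto_inv_smul hCcl hCsmul hwC htw
  set a : ℕ → E := fun j => α⁻¹ • (ξ j - z j) - P (ξ j) - q - adjoint H (η j) with hadef
  set b : ℕ → F := fun j => β⁻¹ • (η j - w j) + H ((2 : ℝ) • z j - ξ j) - g with hbdef
  have hbpol : ∀ j, ∀ y ∈ C, ⟪b j, y⟫ ≤ 0 := fun j y hy => by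
    simpa only [add_sub_cancel_left] using hb j (w j + y) (hCadd _ (hwC j) _ hy)
  have hbw : ∀ j, ⟪b j, w j⟫ = 0 := fun j => by
    refine le_antisymm (hbpol j _ (hwC j)) ?_
    simpa only [zero_smul, zero_sub, inner_neg_right, neg_nonpos] using
      hb j ((0 : ℝ) • w j) (hCsmul _ (hwC j) 0 le_rfl)
  have harec : ∀ j, ⟪a j, zb⟫ ≤ 0 := fun j => by simpa using ha j (zb + z j) (hrec _ (hzD j))
  have hta : Tendsto (fun j : ℕ => (j : ℝ)⁻¹ • a j) atTop (𝓝 (-P zb - adjoint H wb)) := by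
    have h1 := ((((htξ.sub htz).const_smul α⁻¹).sub ((P.continuous.tendsto _).comp htξ)).sub
      (ht.smul_const q)).sub (((adjoint H).continuous.tendsto _).comp htη)
    rw [sub_self, smul_zero, zero_sub, zero_smul, sub_zero] at h1
    refine h1.congr fun j => ?_
    simp only [hadef, Function.comp, map_smul, smul_sub, smul_comm α⁻¹]
  have htb : Tendsto (fun j : ℕ => (j : ℝ)⁻¹ • b j) atTop (𝓝 (H zb)) := by
    have h1 := (((htη.sub htw).const_smul β⁻¹).add ((H.continuous.tendsto _).comp
      ((htz.const_smul (2 : ℝ)).sub htξ))).sub (ht.smul_const g)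
    rw [sub_self, smul_zero, zero_add, zero_smul, sub_zero, two_smul, add_sub_cancel_right] at h1
    refine h1.congr fun j => ?_
    simp only [hbdef, Function.comp, map_smul, map_sub, smul_sub, smul_add, smul_comm β⁻¹,
      smul_comm (2 : ℝ)]
  have hHz : ∀ y ∈ C, ⟪H zb, y⟫ ≤ 0 := fun y hy => by
    refine le_of_tendsto' (htb.inner tendsto_const_nhds) fun j => ?_
    rw [real_inner_smul_left]
    exact mul_nonpos_of_nonneg_of_nonpos (by positivity) (hbpol j y hy)
  have hHzw : ⟪H zb, wb⟫ = 0 := by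
    refine tendsto_nhds_unique (htb.inner htw) (tendsto_const_nhds.congr fun j => ?_)
    rw [real_inner_smul_left, real_inner_smul_right, hbw, mul_zero, mul_zero]
  have hPz : P zb = 0 := by
    refine hP.map_eq_zero_of_inner_nonpos ?_
    have h1 := hta.inner (𝕜 := ℝ) ((ht.smul_const (z 0)).sub htz)
    have h2 := le_of_tendsto' h1 (b := 0) fun j => by
      rw [← smul_sub, real_inner_smul_left, real_inner_smul_right]
      exact mul_nonpos_of_nonneg_of_nonpos (by positivity)
        (mul_nonpos_of_nonneg_of_nonpos (by positivity) (ha j _ (hzD 0)))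
    rw [zero_smul, zero_sub, inner_neg_right, inner_sub_left, inner_neg_left,
      ContinuousLinearMap.adjoint_inner_left, real_inner_comm (H zb) wb, hHzw] at h2
    linarith
  refine ⟨hzl, hrec, hHz, hPz, ?_⟩
  have hHD : Tendsto (fun j => H (z j - ξ j)) atTop (𝓝 (ρ⁻¹ • H zb)) := by
    rw [← map_smul]
    exact (H.continuous.tendsto _).comp hDz
  have lower : -(α⁻¹ * ρ⁻¹ * ‖zb‖ ^ 2) - ⟪q, zb⟫ ≤ 0 := by
    have h1 : Tendsto (fun j => -(α⁻¹ * ⟪z j - ξ j, zb⟫) - ⟪q, zb⟫ + ⟪w j - η j, H zb⟫) atTop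
        (𝓝 (-(α⁻¹ * ⟪ρ⁻¹ • zb, zb⟫) - ⟪q, zb⟫ + ⟪ρ⁻¹ • wb, H zb⟫)) :=
      (((hDz.inner tendsto_const_nhds).const_mul α⁻¹).neg.sub_const _).add
        (hDw.inner tendsto_const_nhds)
    have h2 := le_of_tendsto' h1 (b := 0) fun j => by
      have h3 := harec j
      have h4 := hHz _ (hwC j)
      have h5 := hP.inner_left_eq_inner_right (ξ j) zb
      rw [hPz, inner_zero_right] at h5
      simp only [hadef, inner_sub_left, real_inner_smul_left, h5,
        ContinuousLinearMap.adjoint_inner_left] at h3 ⊢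
      rw [real_inner_comm] at h4
      linarith
    rw [real_inner_smul_left, real_inner_smul_left, real_inner_self_eq_norm_sq,
      real_inner_comm (H zb), hHzw] at h2
    linarith
  set G : ℝ := ⟪g, wb⟫ + β⁻¹ * ρ⁻¹ * ‖wb‖ ^ 2 with hG
  have upper : ∀ x ∈ D, -⟪wb, H x⟫ ≤ -(α⁻¹ * ρ⁻¹ * ‖zb‖ ^ 2) - ⟪q, zb⟫ - G := by
    intro x hx
    have h1 : Tendsto (fun j : ℕ => ⟪(j : ℝ)⁻¹ • a j, x⟫) atTop (𝓝 (-⟪wb, H x⟫)) := by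
      have := hta.inner (𝕜 := ℝ) (tendsto_const_nhds (x := x))
      rwa [hPz, neg_zero, zero_sub, inner_neg_left, ContinuousLinearMap.adjoint_inner_left] at this
    have h2 : Tendsto (fun j : ℕ => ⟪-(α⁻¹ • (z j - ξ j)) - q + P (z j - ξ j), (j : ℝ)⁻¹ • z j⟫ +
        ⟪w j - η j, H ((j : ℝ)⁻¹ • z j)⟫ +
        ⟪-(β⁻¹ • (w j - η j)) + H (z j - ξ j) - g, (j : ℝ)⁻¹ • w j⟫) atTop
        (𝓝 (⟪-(α⁻¹ • ρ⁻¹ • zb) - q + P (ρ⁻¹ • zb), zb⟫ + ⟪ρ⁻¹ • wb, H zb⟫ +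
          ⟪-(β⁻¹ • ρ⁻¹ • wb) + ρ⁻¹ • H zb - g, wb⟫)) :=
      ((((((hDz.const_smul _).neg).sub_const q).add ((P.continuous.tendsto _).comp hDz)).inner
        htz).add (hDw.inner ((H.continuous.tendsto _).comp htz))).add
        (((((hDw.const_smul _).neg).add hHD).sub_const g).inner htw)
    refine (le_of_tendsto_of_tendsto' h1 h2 fun j => ?_).trans_eq ?_
    · have h3 := mul_le_mul_of_nonneg_left (ha j x hx) (by positivity : (0 : ℝ) ≤ (j : ℝ)⁻¹)
      have h4 := congrArg (fun s : ℝ => (j : ℝ)⁻¹ * s) (hbw j)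
      have h5 := mul_nonneg (by positivity : (0 : ℝ) ≤ (j : ℝ)⁻¹) (hP.inner_nonneg_left (z j))
      have h6 := real_inner_comm (w j) (H (z j))
      simp only [hadef, hbdef, map_sub, map_smul, inner_sub_left, inner_sub_right, inner_add_left,
        inner_neg_left, real_inner_smul_left, real_inner_smul_right,
        ContinuousLinearMap.adjoint_inner_left, mul_zero] at h3 h4 ⊢
      rw [h6] at h4 ⊢
      linarith
    · simp only [map_smul, hPz, smul_zero, add_zero, inner_sub_left, inner_add_left,
        inner_neg_left, real_inner_smul_left, real_inner_self_eq_norm_sq, hHzw,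
        real_inner_comm (H zb) wb, hG]
      ring
  have hGlim : Tendsto (fun i => ⟪g, wb⟫ + β⁻¹ * ⟪w i - η i, wb⟫ - ⟪H (z i - ξ i), wb⟫) atTop
      (𝓝 G) := by
    have := (((hDw.inner (tendsto_const_nhds (x := wb))).const_mul β⁻¹).const_add ⟪g, wb⟫).sub
      (hHD.inner (tendsto_const_nhds (x := wb)))
    rw [real_inner_smul_left, real_inner_smul_left, hHzw, mul_zero, sub_zero,
      real_inner_self_eq_norm_sq, ← mul_assoc] at this
    exact this
  have hle : α⁻¹ * ρ⁻¹ * ‖zb‖ ^ 2 + ⟪q, zb⟫ + G ≤ G := by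
    refine ge_of_tendsto' hGlim fun i => ?_
    have h1 := upper (z i) (hzD i)
    have h2 := hbpol i wb hwbC
    have h3 := real_inner_comm wb (H (z i))
    simp only [hbdef, map_sub, map_smul, inner_sub_left, inner_add_left,
      real_inner_smul_left] at h2 ⊢
    linarith
  rw [one_div, mul_inv]
  linarith

end PrimalDual

section Projection

variable {ι : Type*} [Fintype ι] {C : Set (EuclideanSpace ℝ ι)}

theorem exists_forall_norm_sub_le (hne : C.Nonempty) (hcl : IsClosed C) (hcv : Convex ℝ C)
    (x : EuclideanSpace ℝ ι) : ∃ y ∈ C, ∀ c ∈ C, ‖x - y‖ ≤ ‖x - c‖ := by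
  obtain ⟨y, hy, h⟩ := exists_norm_eq_iInf_of_complete_convex hne hcl.isComplete hcv x
  refine ⟨y, hy, fun c hc => h.trans_le ?_⟩
  exact ciInf_le (f := fun c : C => ‖x - c‖)
    ⟨0, by rintro _ ⟨c, rfl⟩; exact norm_nonneg _⟩ ⟨c, hc⟩

theorem proj_mem (hne : C.Nonempty) (hcl : IsClosed C) (hcv : Convex ℝ C)
    (x : EuclideanSpace ℝ ι) : proj C x ∈ C := by
  have h := exists_forall_norm_sub_le hne hcl hcv x
  rw [proj, dif_pos h]
  exact h.choose_spec.1

theorem inner_sub_proj_le_zero (hne : C.Nonempty) (hcl : IsClosed C) (hcv : Convex ℝ C)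
    (x : EuclideanSpace ℝ ι) {y : EuclideanSpace ℝ ι} (hy : y ∈ C) :
    ⟪x - proj C x, y - proj C x⟫ ≤ 0 := by
  have hmin : ∀ c ∈ C, ‖x - proj C x‖ ≤ ‖x - c‖ := by
    have h := exists_forall_norm_sub_le hne hcl hcv x
    rw [proj, dif_pos h]
    exact h.choose_spec.2
  have hmem := proj_mem hne hcl hcv x
  refine (norm_eq_iInf_iff_real_inner_le_zero hcv hmem).1 (le_antisymm ?_ ?_) y hy
  · have : Nonempty C := ⟨⟨_, hmem⟩⟩
    exact le_ciInf fun c => hmin c c.2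
  · exact ciInf_le (f := fun c : C => ‖x - c‖)
      ⟨0, by rintro _ ⟨c, rfl⟩; exact norm_nonneg _⟩ ⟨_, hmem⟩

variable {K : Set (EuclideanSpace ℝ ι)}

theorem zero_mem_polarCone : (0 : EuclideanSpace ℝ ι) ∈ polarCone K := fun y _ => by simp

theorem add_mem_polarCone {x y : EuclideanSpace ℝ ι} (hx : x ∈ polarCone K)
    (hy : y ∈ polarCone K) : x + y ∈ polarCone K := fun k hk => by
  rw [inner_add_left]
  exact add_nonpos (hx k hk) (hy k hk)

theorem smul_mem_polarCone {x : EuclideanSpace ℝ ι} (hx : x ∈ polarCone K) {c : ℝ}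
    (hc : 0 ≤ c) : c • x ∈ polarCone K := fun k hk => by
  rw [real_inner_smul_left]
  exact mul_nonpos_of_nonneg_of_nonpos hc (hx k hk)

theorem convex_polarCone : Convex ℝ (polarCone K) := fun _ hx _ hy _ _ ha hb _ =>
  add_mem_polarCone (smul_mem_polarCone hx ha) (smul_mem_polarCone hy hb)

theorem isClosed_polarCone : IsClosed (polarCone K) := by
  have : polarCone K = ⋂ y ∈ K, {w | ⟪w, y⟫ ≤ 0} := by
    ext
    simp [polarCone]
  rw [this]
  exact isClosed_biInter fun y _ => isClosed_le (by fun_prop) continuous_const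

/-- Bipolar theorem for closed convex cones. -/
theorem mem_of_forall_inner_polarCone_nonpos (hne : K.Nonempty) (hK : IsClosedConvexCone K)
    {b : EuclideanSpace ℝ ι} (hb : ∀ y ∈ polarCone K, ⟪b, y⟫ ≤ 0) : b ∈ K := by
  obtain ⟨hcl, hcv, hsmul⟩ := hK
  have hp := proj_mem hne hcl hcv b
  have hvi : ∀ y ∈ K, ⟪b - proj K b, y - proj K b⟫ ≤ 0 := fun y hy =>
    inner_sub_proj_le_zero hne hcl hcv b hy
  have h0 := hvi _ (hsmul _ hp 0 le_rfl)
  have h2 := hvi _ (hsmul _ hp 2 zero_le_two)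
  rw [inner_sub_right, real_inner_smul_right] at h0 h2
  have hpol : b - proj K b ∈ polarCone K := fun y hy => by
    have := hvi y hy
    rw [inner_sub_right] at this
    linarith
  have h3 := hb _ hpol
  rw [real_inner_comm] at h3
  have h4 : ⟪b - proj K b, b - proj K b⟫ ≤ 0 := by
    rw [inner_sub_right]
    linarith
  rw [real_inner_self_nonpos, sub_eq_zero] at h4
  rwa [h4]

end Projection

theorem mvec_transpose_eq_adjoint {ι κ : Type*} [Fintype ι] [Fintype κ] [DecidableEq ι]
    [DecidableEq κ] (A : Matrix ι κ ℝ) (y : EuclideanSpace ℝ ι) :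
    mvec Aᵀ y =
      ContinuousLinearMap.adjoint (LinearMap.toContinuousLinearMap (Matrix.toEuclideanLin A)) y := by
  rw [← LinearMap.adjoint_toContinuousLinearMap, ← Matrix.toEuclideanLin_conjTranspose_eq_adjoint,
    Matrix.conjTranspose_eq_transpose_of_trivial]
  rfl

/-- the improving-direction identities satisfied by the limit
`z̄ = lim (zʲ⁺¹ − zʲ)` of the xPIPG iterates. -/
theorem stmt8 {n m : ℕ} (P : Matrix (Fin n) (Fin n) ℝ) (q : EuclideanSpace ℝ (Fin n))
    (H : Matrix (Fin m) (Fin n) ℝ) (g : EuclideanSpace ℝ (Fin m))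
    (D : Set (EuclideanSpace ℝ (Fin n))) (K : Set (EuclideanSpace ℝ (Fin m)))
    (hP : P.PosSemidef)
    (hDne : D.Nonempty) (hDcl : IsClosed D) (hDcv : Convex ℝ D)
    (hKne : K.Nonempty) (hK : IsClosedConvexCone K)
    (α β ρ : ℝ) (hα : 0 < α) (hβ : 0 < β)
    (hstep : α * (specNorm P + β * specNorm H ^ 2) < 1)
    (hρ : ρ ∈ Set.Ioo (0 : ℝ) 2)
    (z ξ : ℕ → EuclideanSpace ℝ (Fin n)) (w η : ℕ → EuclideanSpace ℝ (Fin m))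
    (hz : ∀ j, 1 ≤ j → z (j + 1) = proj D (ξ j - α • (mvec P (ξ j) + q + mvec Hᵀ (η j))))
    (hw : ∀ j, 1 ≤ j → w (j + 1) =
      proj (polarCone K) (η j + β • (mvec H ((2 : ℝ) • z (j + 1) - ξ j) - g)))
    (hξ : ∀ j, 1 ≤ j → ξ (j + 1) = (1 - ρ) • ξ j + ρ • z (j + 1))
    (hη : ∀ j, 1 ≤ j → η (j + 1) = (1 - ρ) • η j + ρ • w (j + 1)) :
    ∃ zbar : EuclideanSpace ℝ (Fin n),
      Tendsto (fun j : ℕ => z (j + 1) - z j) atTop (𝓝 zbar) ∧ zbar ∈ recCone D ∧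
      mvec H zbar ∈ K ∧ mvec P zbar = 0 ∧ ⟪q, zbar⟫ = -(1 / (ρ * α)) * ‖zbar‖ ^ 2 := by
  set Pc : EuclideanSpace ℝ (Fin n) →L[ℝ] EuclideanSpace ℝ (Fin n) :=
    LinearMap.toContinuousLinearMap (Matrix.toEuclideanLin P) with hPc
  set Hc : EuclideanSpace ℝ (Fin n) →L[ℝ] EuclideanSpace ℝ (Fin m) :=
    LinearMap.toContinuousLinearMap (Matrix.toEuclideanLin H) with hHc
  have hPpos : Pc.IsPositive :=
    (LinearMap.isPositive_toContinuousLinearMap_iff _).2 (Matrix.isPositive_toEuclideanLin_iff.2 hP)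
  have hCne : (polarCone K).Nonempty := ⟨0, zero_mem_polarCone⟩
  have hzD : ∀ j, z (j + 2) ∈ D := fun j => by
    rw [hz (j + 1) (by omega)]
    exact proj_mem hDne hDcl hDcv _
  have hwC : ∀ j, w (j + 2) ∈ polarCone K := fun j => by
    rw [hw (j + 1) (by omega)]
    exact proj_mem hCne isClosed_polarCone convex_polarCone _
  have ha : ∀ j, ∀ x ∈ D, ⟪α⁻¹ • (ξ (j + 1) - z (j + 2)) - Pc (ξ (j + 1)) - q -
      ContinuousLinearMap.adjoint Hc (η (j + 1)), x - z (j + 2)⟫ ≤ 0 := fun j x hx => by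
    have h := inner_sub_proj_le_zero hDne hDcl hDcv
      (ξ (j + 1) - α • (mvec P (ξ (j + 1)) + q + mvec Hᵀ (η (j + 1)))) hx
    rw [← hz (j + 1) (by omega), mvec_transpose_eq_adjoint] at h
    have e : α⁻¹ • (ξ (j + 1) - z (j + 2)) - Pc (ξ (j + 1)) - q -
        ContinuousLinearMap.adjoint Hc (η (j + 1)) = α⁻¹ • (ξ (j + 1) - α • (mvec P (ξ (j + 1)) +
          q + ContinuousLinearMap.adjoint Hc (η (j + 1))) - z (j + 2)) := by
      rw [sub_right_comm (ξ (j + 1)) (α • _), smul_sub _ (ξ (j + 1) - z (j + 2)), inv_smul_smul₀ hα.ne', sub_sub,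
        sub_sub, add_assoc]
      rfl
    rw [e, real_inner_smul_left]
    exact mul_nonpos_of_nonneg_of_nonpos (by positivity) h
  have hb : ∀ j, ∀ y ∈ polarCone K, ⟪β⁻¹ • (η (j + 1) - w (j + 2)) +
      Hc ((2 : ℝ) • z (j + 2) - ξ (j + 1)) - g, y - w (j + 2)⟫ ≤ 0 := fun j y hy => by
    have h := inner_sub_proj_le_zero hCne isClosed_polarCone convex_polarCone
      (η (j + 1) + β • (mvec H ((2 : ℝ) • z (j + 2) - ξ (j + 1)) - g)) hy
    rw [← hw (j + 1) (by omega)] at h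
    have e : β⁻¹ • (η (j + 1) - w (j + 2)) + Hc ((2 : ℝ) • z (j + 2) - ξ (j + 1)) - g =
        β⁻¹ • (η (j + 1) + β • (mvec H ((2 : ℝ) • z (j + 2) - ξ (j + 1)) - g) - w (j + 2)) := by
      rw [add_sub_right_comm (η (j + 1)), smul_add, inv_smul_smul₀ hβ.ne', ← add_sub_assoc]
      rfl
    rw [e, real_inner_smul_left]
    exact mul_nonpos_of_nonneg_of_nonpos (by positivity) h
  have hξ' : ∀ j, ξ (j + 1 + 1) - ξ (j + 1) = ρ • (z (j + 2) - ξ (j + 1)) := fun j => by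
    rw [hξ (j + 1) (by omega)]
    module
  have hη' : ∀ j, η (j + 1 + 1) - η (j + 1) = ρ • (w (j + 2) - η (j + 1)) := fun j => by
    rw [hη (j + 1) (by omega)]
    module
  obtain ⟨⟨zb, hzb⟩, wb, hwb⟩ := exists_tendsto_sub_of_primal_dual
    (z := fun j => z (j + 2)) (ξ := fun j => ξ (j + 1)) (w := fun j => w (j + 2))
    (η := fun j => η (j + 1)) hPpos hα hβ hstep hρ.1 hρ.2 hzD hwC ha hb hξ' hη'
  obtain ⟨h1, h2, h3, h4, h5⟩ := improving_direction_of_primal_dual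
    (z := fun j => z (j + 2)) (ξ := fun j => ξ (j + 1)) (w := fun j => w (j + 2))
    (η := fun j => η (j + 1)) hPpos hρ.1 hDcl hDcv isClosed_polarCone
    (fun _ hx _ hy => add_mem_polarCone hx hy) (fun _ hx _ hc => smul_mem_polarCone hx hc)
    hzD hwC ha hb hξ' hη' hzb hwb
  exact ⟨zb, (tendsto_add_atTop_iff_nat (f := fun j => z (j + 1) - z j) 2).1 h1, h2,
    mem_of_forall_inner_polarCone_nonpos hKne hK h3, h4, h5⟩
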